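/- arXiv:1502.03945 — 2 statements merged into one kernel-verified Lean document; each statement's English description precedes it below -/
import Mathlib

section
/- For every real χ > 2, consider the price competition game with a single non-abstain vendor of production cost 0 and two buyer types of volume 1 each, with valuations χ and 1 for the vendor. Then the optimal social welfare is SW* = χ + 1, and for every price p to which the optimal assignment x (assigning both buyer types to the vendor) is consistent, the subsidy of the vendor satisfies s(x,p) ≥ χ − 2. Consequently, for every ε > 0 there exists a price competition game in which the optimal assignment cannot be enforced as an equilibrium with a total amount of subsidies less than (1 − ε)·SW*. -/
open Finset

/-- A price competition game with buyer types `N` and vendors `M`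
(including the special "abstain" vendor). -/
structure PCGame (N M : Type) [Fintype N] [Fintype M] where
  abstain : M
  μ : N → ℝ
  v : N → M → ℝ
  c : M → ℝ
  μ_pos : ∀ i, 0 < μ i
  v_nonneg : ∀ i j, 0 ≤ v i j
  c_nonneg : ∀ j, 0 ≤ c j
  v_abstain : ∀ i, v i abstain = 0
  c_abstain : c abstain = 0

namespace PCGame

variable {N M : Type} [Fintype N] [Fintype M]

/-- `p` is a valid price vector: every price is at least the production cost and
the abstain vendor has price `0`. -/
def IsPrice (G : PCGame N M) (p : M → ℝ) : Prop :=
  (∀ j, G.c j ≤ p j) ∧ p G.abstain = 0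

/-- `x` is a valid buyers-to-vendors assignment. -/
def IsAssignment (G : PCGame N M) (x : N → M → ℝ) : Prop :=
  (∀ i j, 0 ≤ x i j) ∧ ∀ i, ∑ j, x i j = G.μ i

/-- `x` is consistent to `p`: positive volume goes only to utility-maximizing vendors. -/
def Consistent (G : PCGame N M) (x : N → M → ℝ) (p : M → ℝ) : Prop :=
  ∀ i j, 0 < x i j → ∀ j', G.v i j' - p j' ≤ G.v i j - p j

/-- Utility of vendor `j` under assignment `x` and prices `p`. -/
noncomputable def util (G : PCGame N M) (x : N → M → ℝ) (p : M → ℝ) (j : M) : ℝ :=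
  (p j - G.c j) * ∑ i, x i j

/-- Total utility of the buyers of type `i`. -/
noncomputable def buyerUtil (G : PCGame N M) (x : N → M → ℝ) (p : M → ℝ) (i : N) : ℝ :=
  ∑ j, x i j * (G.v i j - p j)

/-- `(x, p)` is a (pure Nash) equilibrium: `x` is consistent to `p` and no (non-abstain)
vendor can increase its utility by deviating to another price. -/
def IsEquilibrium [DecidableEq M] (G : PCGame N M) (x : N → M → ℝ) (p : M → ℝ) : Prop :=
  G.IsPrice p ∧ G.IsAssignment x ∧ G.Consistent x p ∧
    ∀ j, j ≠ G.abstain → ∀ p' : ℝ, G.c j ≤ p' →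
      ∀ y, G.IsAssignment y → G.Consistent y (Function.update p j p') →
        G.util y (Function.update p j p') j ≤ G.util x p j

/-- Social welfare of assignment `x`. -/
noncomputable def SW (G : PCGame N M) (x : N → M → ℝ) : ℝ :=
  ∑ i, ∑ j, x i j * (G.v i j - G.c j)

/-- Optimal social welfare. -/
noncomputable def SWopt (G : PCGame N M) : ℝ :=
  ∑ i, G.μ i * Finset.univ.sup' ⟨G.abstain, Finset.mem_univ _⟩ (fun j => G.v i j - G.c j)

/-- `θ_j(p)`: the supremum utility of vendor `j` over all of its price deviations
(the abstain vendor cannot deviate from price `0`). -/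
noncomputable def theta [DecidableEq M] (G : PCGame N M) (p : M → ℝ) (j : M) : ℝ :=
  sSup {u : ℝ | ∃ (p' : ℝ) (y : N → M → ℝ), G.c j ≤ p' ∧ (j = G.abstain → p' = 0) ∧
    G.IsAssignment y ∧ G.Consistent y (Function.update p j p') ∧
    u = G.util y (Function.update p j p') j}

/-- The minimum subsidy that makes vendor `j` not want to deviate from `(x, p)`. -/
noncomputable def subsidy [DecidableEq M] (G : PCGame N M) (x : N → M → ℝ) (p : M → ℝ)
    (j : M) : ℝ :=
  G.theta p j - G.util x p j

end PCGame

namespace PCGame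

/-- The vendor `abstain` never needs a subsidy: its price is always `0`. -/
theorem subsidy_abstain {N M : Type} [Fintype N] [Fintype M] [DecidableEq M]
    (G : PCGame N M) (x : N → M → ℝ) {p : M → ℝ} (hp : p G.abstain = 0) :
    G.subsidy x p G.abstain = 0 := by
  have hx : G.util x p G.abstain = 0 := by simp [util, hp, G.c_abstain]
  have hθ : G.theta p G.abstain = 0 := by
    unfold theta
    apply le_antisymm
    · apply Real.sSup_nonpos
      rintro u ⟨p', y, -, h0, -, -, rfl⟩
      simp [util, h0 rfl, G.c_abstain]
    · apply Real.sSup_nonneg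
      rintro u ⟨p', y, -, h0, -, -, rfl⟩
      simp [util, h0 rfl, G.c_abstain]
  rw [subsidy, hx, hθ, sub_zero]

section TwoBuyers

variable {χ : ℝ} {G : PCGame Bool Bool}

theorem SWopt_two_buyers (hab : G.abstain = false) (hμ : ∀ i, G.μ i = 1)
    (hc : G.c true = 0) (hv1 : G.v true true = χ) (hv2 : G.v false true = 1) :
    G.SWopt = χ + 1 := by
  have hv : ∀ i, G.v i false = 0 := fun i => hab ▸ G.v_abstain i
  have hcf : G.c false = 0 := hab ▸ G.c_abstain
  have hsup : ∀ i, Finset.univ.sup' ⟨G.abstain, Finset.mem_univ _⟩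
      (fun j => G.v i j - G.c j) = G.v i true := by
    intro i
    apply le_antisymm
    · apply Finset.sup'_le
      rintro (_ | _) -
      · simpa [hv, hcf] using G.v_nonneg i true
      · simp [hc]
    · simp [hc]
  simp only [SWopt, hsup, hμ, Fintype.sum_bool, hv1, hv2, one_mul]

theorem le_theta_two_buyers (hχ : 1 ≤ χ) (hab : G.abstain = false) (hμ : ∀ i, G.μ i = 1)
    (hc : G.c true = 0) (hv1 : G.v true true = χ) (hv2 : G.v false true = 1)
    {p : Bool → ℝ} (hp : p false = 0) : χ ≤ G.theta p true := by
  have hv : ∀ i, G.v i false = 0 := fun i => hab ▸ G.v_abstain i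
  apply le_csSup
  · refine ⟨2 * χ, ?_⟩
    rintro u ⟨p', y, hp', -, ⟨hy0, hy⟩, hcon, rfl⟩
    rw [hc] at hp'
    have hbuyer : ∀ i, p' * y i true ≤ χ := by
      intro i
      have hyi := hy i
      rw [Fintype.sum_bool, hμ] at hyi
      have hle : y i true ≤ 1 := by linarith [hy0 i false]
      rcases (hy0 i true).eq_or_lt with h | h
      · rw [← h]; linarith
      · have hutil := hcon i true h false
        simp only [hv, Function.update_self, ne_eq, Bool.false_eq_true, not_false_eq_true,
          Function.update_of_ne, hp] at hutil
        have hvi : G.v i true ≤ χ := by cases i <;> simp only [hv1, hv2] <;> linarith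
        nlinarith
    simp only [util, Function.update_self, hc, Fintype.sum_bool]
    linarith [hbuyer true, hbuyer false]
  · refine ⟨χ, fun i j => if i = j then 1 else 0, by linarith, by simp [hab], ⟨?_, ?_⟩, ?_, ?_⟩
    · intro i j; dsimp only; split_ifs <;> norm_num
    · intro i; simp [hμ]
    · intro i j h j'
      cases i <;> cases j <;> cases j' <;> simp_all
    · simp [util, hc]

theorem subsidy_two_buyers (hχ : 1 ≤ χ) (hab : G.abstain = false) (hμ : ∀ i, G.μ i = 1)
    (hc : G.c true = 0) (hv1 : G.v true true = χ) (hv2 : G.v false true = 1)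
    {p : Bool → ℝ} (hp : G.IsPrice p)
    (hx : G.Consistent (fun _ j => if j = true then 1 else 0) p) :
    χ - 2 ≤ G.subsidy (fun _ j => if j = true then 1 else 0) p true := by
  have hpf : p false = 0 := hab ▸ hp.2
  have hθ := le_theta_two_buyers hχ hab hμ hc hv1 hv2 hpf
  have hvf : G.v false false = 0 := hab ▸ G.v_abstain false
  have hle := hx false true (by simp) false
  rw [hvf, hpf, hv2] at hle
  simp only [subsidy, util, hc, Fintype.sum_bool, if_true]
  linarith

end TwoBuyers

/-- The game with one vendor of cost `0` and two unit-volume buyer types with valuations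
`χ` and `1`. -/
def twoBuyers (χ : ℝ) (hχ : 0 ≤ χ) : PCGame Bool Bool where
  abstain := false
  μ _ := 1
  v i j := if j then (if i then χ else 1) else 0
  c _ := 0
  μ_pos _ := one_pos
  v_nonneg i j := by cases i <;> cases j <;> simp [hχ]
  c_nonneg _ := le_rfl
  v_abstain _ := by simp
  c_abstain := rfl

end PCGame

/-- in the one-vendor game with buyer valuations `χ` and `1`,
the optimal social welfare is `χ + 1` and enforcing the optimal assignment needs a
subsidy of at least `χ - 2`; consequently enforcing the optimal assignment may
require subsidies of cost at least `(1 - ε)·SW*`.  Buyer `true` has valuation `χ`,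
buyer `false` has valuation `1`; vendor `false` is the abstain option and vendor
`true` is the real vendor. -/
theorem stmt14 (χ : ℝ) (hχ : 2 < χ)
    (G : PCGame Bool Bool)
    (hab : G.abstain = false)
    (hμ : ∀ i, G.μ i = 1)
    (hc : G.c true = 0)
    (hv1 : G.v true true = χ) (hv2 : G.v false true = 1)
    (x : Bool → Bool → ℝ)
    (hx : x = fun _ j => if j = true then 1 else 0) :
    G.SWopt = χ + 1 ∧
    (∀ p : Bool → ℝ, G.IsPrice p → G.Consistent x p → χ - 2 ≤ G.subsidy x p true) ∧
    (∀ ε : ℝ, 0 < ε → ∃ (G' : PCGame Bool Bool) (x' : Bool → Bool → ℝ),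
      G'.IsAssignment x' ∧ G'.SW x' = G'.SWopt ∧
      ∀ p : Bool → ℝ, G'.IsPrice p → G'.Consistent x' p →
        (1 - ε) * G'.SWopt ≤ ∑ j, G'.subsidy x' p j) := by
  refine ⟨PCGame.SWopt_two_buyers hab hμ hc hv1 hv2, ?_, ?_⟩
  · intro p hp hcon
    subst hx
    exact PCGame.subsidy_two_buyers (by linarith) hab hμ hc hv1 hv2 hp hcon
  · intro ε hε
    have hpos : 0 < 3 / ε := by positivity
    have hχ' : 0 ≤ 3 / ε + 3 := by positivity
    have hopt : (PCGame.twoBuyers (3 / ε + 3) hχ').SWopt = 3 / ε + 3 + 1 :=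
      PCGame.SWopt_two_buyers rfl (fun _ => rfl) rfl
        (by simp [PCGame.twoBuyers]) (by simp [PCGame.twoBuyers])
    refine ⟨PCGame.twoBuyers (3 / ε + 3) hχ', fun _ j => if j = true then 1 else 0,
      ⟨?_, ?_⟩, ?_, ?_⟩
    · intro i j; dsimp only; split_ifs <;> norm_num
    · intro i; simp [PCGame.twoBuyers]
    · rw [hopt]; simp [PCGame.SW, PCGame.twoBuyers]
    · intro p hp hcon
      have hsub := PCGame.subsidy_two_buyers (χ := 3 / ε + 3) (by linarith) rfl (fun _ => rfl) rfl
        (by simp [PCGame.twoBuyers]) (by simp [PCGame.twoBuyers]) hp hcon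
      have habs : (PCGame.twoBuyers (3 / ε + 3) hχ').subsidy
          (fun _ j => if j = true then 1 else 0) p false = 0 :=
        PCGame.subsidy_abstain _ _ hp.2
      rw [Fintype.sum_bool, habs, hopt]
      have hcancel : ε * (3 / ε) = 3 := by field_simp
      nlinarith
end

section
/- Let k ≥ 2, let G be a k-uniform hypergraph, consider the price competition game constructed from G with its optimal assignment x̂, and let p be any price vector to which x̂ is consistent. Then for every auxiliary vendor j*, every edge vendor e, and every node vendor j: (i) s_{j*}(x̂,p) = (1/(k+2))·min{k+3, p_j + 1} − (1/(k+2))·p_{j*}; (ii) s_e(x̂,p) = max{ (k+1)², (k+1)·min_{j_i ∈ e}(p_{j_i} − 1) } − p_e; (iii) s_j(x̂,p) = max{ ((k+3)/(k+2))·min{ p_{j*} − 1, 1 + min{k+2, min_{e : j ∈ e} p_e} }, γ_j·max{ p_{j*} − 1, 1 + min{k+2, min_{e : j ∈ e} p_e} } } − p_j, where γ_j = 1/(k+2) if p_{j*} − 1 ≥ 1 + min{k+2, min_{e : j ∈ e} p_e} and γ_j = 1 otherwise. -/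
open Finset

namespace PCGame

variable {N M : Type} [Fintype N] [Fintype M]

/-- Buyers of type `i` weakly prefer vendor `m` at price `t` to every other vendor
at its price under `p`. -/
def Accepts (G : PCGame N M) (p : M → ℝ) (m : M) (t : ℝ) (i : N) : Prop :=
  ∀ m', m' ≠ m → G.v i m' - p m' ≤ G.v i m - t

open Classical in
/-- The largest volume vendor `m` can attract at price `t`, the other prices being `p`. -/
noncomputable def demand (G : PCGame N M) (p : M → ℝ) (m : M) (t : ℝ) : ℝ :=
  ∑ i, if G.Accepts p m t i then G.μ i else 0

theorem demand_nonneg (G : PCGame N M) (p : M → ℝ) (m : M) (t : ℝ) : 0 ≤ G.demand p m t := by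
  refine Finset.sum_nonneg fun i _ => ?_
  split_ifs
  exacts [(G.μ_pos i).le, le_rfl]

theorem Consistent.accepts [DecidableEq M] {G : PCGame N M} {p : M → ℝ} {m : M} {t : ℝ}
    {y : N → M → ℝ} (hy : G.Consistent y (Function.update p m t)) {i : N} (hi : 0 < y i m) :
    G.Accepts p m t i := by
  intro m' hm'
  simpa [hm'] using hy i m hi m'

/-- In any assignment consistent to the deviation price, the volume of the deviating vendor
is at most its demand. -/
theorem Consistent.sum_le_demand [DecidableEq M] {G : PCGame N M} {p : M → ℝ} {m : M} {t : ℝ}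
    {y : N → M → ℝ} (hy : G.Consistent y (Function.update p m t)) (ha : G.IsAssignment y) :
    ∑ i, y i m ≤ G.demand p m t := by
  refine Finset.sum_le_sum fun i _ => ?_
  split_ifs with h
  · rw [← ha.2 i]
    exact Finset.single_le_sum (f := y i) (fun j _ => ha.1 i j) (Finset.mem_univ m)
  · by_contra! hpos
    exact h (hy.accepts hpos)

/-- Some assignment consistent to the deviation price realizes the demand. -/
theorem exists_consistent_sum_eq_demand [DecidableEq M] (G : PCGame N M) (p : M → ℝ) (m : M)
    (t : ℝ) : ∃ y, G.IsAssignment y ∧ G.Consistent y (Function.update p m t) ∧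
      ∑ i, y i m = G.demand p m t := by
  have key : ∀ i, ∃ b, (∀ m', G.v i m' - Function.update p m t m' ≤
      G.v i b - Function.update p m t b) ∧ (b = m ↔ G.Accepts p m t i) := by
    intro i
    by_cases h : G.Accepts p m t i
    · refine ⟨m, fun m' => ?_, by simp [h]⟩
      by_cases hm : m' = m
      · rw [hm]
      · simpa [hm] using h m' hm
    · have : Nonempty M := ⟨m⟩
      obtain ⟨b, hb⟩ := Finite.exists_max fun m' => G.v i m' - Function.update p m t m'
      refine ⟨b, hb, fun hbm => ?_, fun h' => absurd h' h⟩
      intro m' hm'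
      simpa [hbm, hm'] using hb m'
  choose b hb hbm using key
  refine ⟨fun i m' => if m' = b i then G.μ i else 0, ⟨fun i j => ?_, fun i => by simp⟩,
    fun i j hij => ?_, ?_⟩
  · dsimp only
    split_ifs
    exacts [(G.μ_pos i).le, le_rfl]
  · have : j = b i := by
      by_contra h
      simp [h] at hij
    exact this ▸ hb i
  · refine Finset.sum_congr rfl fun i _ => ?_
    simp only [← hbm, eq_comm]

/-- `θ` is the maximum of price times demand over positive prices. -/
theorem theta_eq_of_demand [DecidableEq M] (G : PCGame N M) (p : M → ℝ) {m : M}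
    (hm : m ≠ G.abstain) (hc : G.c m = 0) {θ : ℝ} (h0 : 0 ≤ θ)
    (hub : ∀ t, 0 < t → t * G.demand p m t ≤ θ)
    (hex : ∃ t, 0 < t ∧ θ ≤ t * G.demand p m t) : G.theta p m = θ := by
  refine IsGreatest.csSup_eq ⟨?_, ?_⟩
  · obtain ⟨t, ht, hθ⟩ := hex
    obtain ⟨y, hya, hyc, hys⟩ := G.exists_consistent_sum_eq_demand p m t
    refine ⟨t, y, hc ▸ ht.le, fun h => absurd h hm, hya, hyc, ?_⟩
    simp only [util, Function.update_self, hc, hys, sub_zero]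
    exact le_antisymm hθ (hub t ht)
  · rintro _ ⟨t, y, ht, -, hya, hyc, rfl⟩
    simp only [util, Function.update_self, hc, sub_zero]
    rw [hc] at ht
    rcases ht.eq_or_lt with rfl | ht
    · simpa using h0
    · exact (mul_le_mul_of_nonneg_left (hyc.sum_le_demand hya) ht.le).trans (hub t ht)

/-- Buyers that do not value a vendor never accept a positive price. -/
theorem not_accepts_of_v_eq_zero (G : PCGame N M) {p : M → ℝ} (hp : G.IsPrice p) {m : M}
    (hm : m ≠ G.abstain) {t : ℝ} (ht : 0 < t) {i : N} (hv : G.v i m = 0) :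
    ¬ G.Accepts p m t i := by
  intro h
  have := h G.abstain hm.symm
  rw [G.v_abstain, hp.2, hv] at this
  linarith

end PCGame

/-- the closed-form subsidy expressions for auxiliary, edge and node
vendors in the node-cover game, for every price vector to which the optimal
assignment is consistent.  (Same encoding of buyers and vendors as in Statement 15.) -/
theorem stmt17 {V : Type} [Fintype V] [DecidableEq V] (k : ℕ) (hk : 2 ≤ k)
    (E : Finset (Finset V)) (hE : ∀ S ∈ E, S.card = k)
    (G : PCGame (↥E ⊕ V ⊕ V) (Option (↥E ⊕ V ⊕ V)))
    (hab : G.abstain = none)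
    (hμe : ∀ e : ↥E, G.μ (Sum.inl e) = 1)
    (hμj : ∀ j : V, G.μ (Sum.inr (Sum.inl j)) = 1)
    (hμs : ∀ j : V, G.μ (Sum.inr (Sum.inr j)) = 1 / ((k : ℝ) + 2))
    (hcost : ∀ m, G.c m = 0)
    (hve : ∀ e e' : ↥E, G.v (Sum.inl e) (some (Sum.inl e')) =
      if e = e' then ((k : ℝ) + 1) ^ 2 else 0)
    (hven : ∀ (e : ↥E) (j : V), G.v (Sum.inl e) (some (Sum.inr (Sum.inl j))) = 0)
    (hvea : ∀ (e : ↥E) (j : V), G.v (Sum.inl e) (some (Sum.inr (Sum.inr j))) = 0)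
    (hvje : ∀ (j : V) (e : ↥E), G.v (Sum.inr (Sum.inl j)) (some (Sum.inl e)) =
      if j ∈ e.1 then (k : ℝ) + 2 else 0)
    (hvjn : ∀ j j' : V, G.v (Sum.inr (Sum.inl j)) (some (Sum.inr (Sum.inl j'))) =
      if j = j' then (k : ℝ) + 3 else 0)
    (hvja : ∀ j j' : V, G.v (Sum.inr (Sum.inl j)) (some (Sum.inr (Sum.inr j'))) = 0)
    (hvse : ∀ (j : V) (e : ↥E), G.v (Sum.inr (Sum.inr j)) (some (Sum.inl e)) = 0)
    (hvsn : ∀ j j' : V, G.v (Sum.inr (Sum.inr j)) (some (Sum.inr (Sum.inl j'))) =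
      if j = j' then (k : ℝ) + 2 else 0)
    (hvsa : ∀ j j' : V, G.v (Sum.inr (Sum.inr j)) (some (Sum.inr (Sum.inr j'))) =
      if j = j' then (k : ℝ) + 3 else 0)
    (xhat : (↥E ⊕ V ⊕ V) → Option (↥E ⊕ V ⊕ V) → ℝ)
    (hxe : ∀ (e : ↥E) m, xhat (Sum.inl e) m = if m = some (Sum.inl e) then 1 else 0)
    (hxj : ∀ (j : V) m, xhat (Sum.inr (Sum.inl j)) m =
      if m = some (Sum.inr (Sum.inl j)) then 1 else 0)
    (hxs : ∀ (j : V) m, xhat (Sum.inr (Sum.inr j)) m =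
      if m = some (Sum.inr (Sum.inr j)) then 1 / ((k : ℝ) + 2) else 0) :
    ∀ p : Option (↥E ⊕ V ⊕ V) → ℝ, G.IsPrice p → G.Consistent xhat p →
      (∀ j : V, G.subsidy xhat p (some (Sum.inr (Sum.inr j))) =
        (1 / ((k : ℝ) + 2)) * min ((k : ℝ) + 3) (p (some (Sum.inr (Sum.inl j))) + 1) -
          (1 / ((k : ℝ) + 2)) * p (some (Sum.inr (Sum.inr j)))) ∧
      (∀ e : ↥E, G.subsidy xhat p (some (Sum.inl e)) =
        max (((k : ℝ) + 1) ^ 2)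
          (((k : ℝ) + 1) *
            e.1.inf' (Finset.card_pos.mp (by rw [hE e.1 e.2]; omega))
              (fun j => p (some (Sum.inr (Sum.inl j))) - 1)) -
          p (some (Sum.inl e))) ∧
      (∀ j : V,
        let A : ℝ := p (some (Sum.inr (Sum.inr j))) - 1
        let B : ℝ := 1 + (insert ((k : ℝ) + 2)
            ((E.attach.filter (fun e => j ∈ e.1)).image
              (fun e => p (some (Sum.inl e))))).inf'
            (Finset.insert_nonempty _ _) id
        G.subsidy xhat p (some (Sum.inr (Sum.inl j))) =
          max ((((k : ℝ) + 3) / ((k : ℝ) + 2)) * min A B)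
            ((if B ≤ A then 1 / ((k : ℝ) + 2) else 1) * max A B) -
            p (some (Sum.inr (Sum.inl j)))) := by
  classical
  intro p hp hcons
  have hk' : (2 : ℝ) ≤ k := by exact_mod_cast hk
  have hp0 : ∀ m, 0 ≤ p m := fun m => by simpa [hcost] using hp.1 m
  have hpn : p none = 0 := hab ▸ hp.2
  have hvn : ∀ i, G.v i none = 0 := fun i => hab ▸ G.v_abstain i
  have hsome : ∀ m, some m ≠ G.abstain := fun m => by simp [hab]
  have hk2 : 0 < 1 / ((k : ℝ) + 2) := by positivity
  have hnode : ∀ j m', G.v (Sum.inr (Sum.inl j)) m' - p m' ≤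
      (k : ℝ) + 3 - p (some (Sum.inr (Sum.inl j))) := fun j m' => by
    simpa [hvjn] using hcons (Sum.inr (Sum.inl j)) (some (Sum.inr (Sum.inl j))) (by simp [hxj]) m'
  have haux : ∀ j m', G.v (Sum.inr (Sum.inr j)) m' - p m' ≤
      (k : ℝ) + 3 - p (some (Sum.inr (Sum.inr j))) := fun j m' => by
    simpa [hvsa] using hcons (Sum.inr (Sum.inr j)) (some (Sum.inr (Sum.inr j)))
      (by rw [hxs, if_pos rfl]; exact hk2) m'
  have hq : ∀ j, p (some (Sum.inr (Sum.inl j))) ≤ (k : ℝ) + 3 := fun j => by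
    have := hnode j none
    rw [hvn, hpn] at this
    linarith
  have hqe : ∀ (j : V) (e : ↥E), j ∈ e.1 →
      p (some (Sum.inr (Sum.inl j))) ≤ 1 + p (some (Sum.inl e)) := fun j e hj => by
    have := hnode j (some (Sum.inl e))
    rw [hvje, if_pos hj] at this
    linarith
  have haq : ∀ j, p (some (Sum.inr (Sum.inr j))) ≤ p (some (Sum.inr (Sum.inl j))) + 1 := fun j => by
    have := haux j (some (Sum.inr (Sum.inl j)))
    rw [hvsn, if_pos rfl] at this
    linarith
  have hna : ∀ {m i} {t : ℝ}, 0 < t → G.v i (some m) = 0 → ¬ G.Accepts p (some m) t i :=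
    fun ht hv => G.not_accepts_of_v_eq_zero hp (hsome _) ht hv
  refine ⟨fun j => ?_, fun e => ?_, fun j => ?_⟩
  · have hacc : ∀ t, G.Accepts p (some (Sum.inr (Sum.inr j))) t (Sum.inr (Sum.inr j)) ↔
        t ≤ min ((k : ℝ) + 3) (p (some (Sum.inr (Sum.inl j))) + 1) := by
      intro t
      rw [le_min_iff]
      constructor
      · intro h
        have h1 := h none (by simp)
        have h2 := h (some (Sum.inr (Sum.inl j))) (by simp)
        simp only [hvn, hpn, hvsn, hvsa, if_true] at h1 h2
        constructor <;> linarith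
      · rintro ⟨h1, h2⟩ (_ | e | j' | j') hne
        · simp only [hvn, hpn, hvsa, if_true]
          linarith
        · have := hp0 (some (Sum.inl e))
          simp only [hvse, hvsa, if_true]
          linarith
        · have := hp0 (some (Sum.inr (Sum.inl j')))
          by_cases hj : j = j'
          · subst hj
            simp only [hvsn, hvsa, if_true]
            linarith
          · simp only [hvsn, hvsa, if_true, if_neg hj]
            linarith
        · have := hp0 (some (Sum.inr (Sum.inr j')))
          have hj : j ≠ j' := by
            rintro rfl
            exact hne rfl
          simp only [hvsa, if_true, if_neg hj]
          linarith
    have hdem : ∀ t, 0 < t → G.demand p (some (Sum.inr (Sum.inr j))) t =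
        if t ≤ min ((k : ℝ) + 3) (p (some (Sum.inr (Sum.inl j))) + 1)
          then 1 / ((k : ℝ) + 2) else 0 := by
      intro t ht
      rw [PCGame.demand, Fintype.sum_eq_single (Sum.inr (Sum.inr j))]
      · simp only [hacc, hμs]
      · rintro (e | j' | j') hne
        · exact if_neg (hna ht (hvea e j))
        · exact if_neg (hna ht (hvja j' j))
        · refine if_neg (hna ht ?_)
          rw [hvsa, if_neg]
          rintro rfl
          exact hne rfl
    have hmin : 0 < min ((k : ℝ) + 3) (p (some (Sum.inr (Sum.inl j))) + 1) :=
      lt_min (by linarith) (by linarith [hp0 (some (Sum.inr (Sum.inl j)))])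
    rw [PCGame.subsidy, G.theta_eq_of_demand p (hsome _) (hcost _)
      (θ := 1 / ((k : ℝ) + 2) * min ((k : ℝ) + 3) (p (some (Sum.inr (Sum.inl j))) + 1))]
    · simp [PCGame.util, hxe, hxj, hxs, hcost, Fintype.sum_sum_type, mul_comm]
    · positivity
    · intro t ht
      rw [hdem t ht]
      split_ifs with h
      · rw [mul_comm]
        exact mul_le_mul_of_nonneg_left h hk2.le
      · rw [mul_zero]
        positivity
    · refine ⟨_, hmin, ?_⟩
      rw [hdem _ hmin, if_pos le_rfl, mul_comm]
  · have hacce : ∀ t, G.Accepts p (some (Sum.inl e)) t (Sum.inl e) ↔ t ≤ ((k : ℝ) + 1) ^ 2 := by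
      intro t
      constructor
      · intro h
        have h1 := h none (by simp)
        simp only [hvn, hpn, hve, if_true] at h1
        linarith
      · rintro h (_ | e' | j' | j') hne
        · simp only [hvn, hpn, hve, if_true]
          linarith
        · have := hp0 (some (Sum.inl e'))
          have he : e ≠ e' := by
            rintro rfl
            exact hne rfl
          simp only [hve, if_true, if_neg he]
          linarith
        · have := hp0 (some (Sum.inr (Sum.inl j')))
          simp only [hve, hven, if_true]
          linarith
        · have := hp0 (some (Sum.inr (Sum.inr j')))
          simp only [hve, hvea, if_true]
          linarith
    have haccn : ∀ t, 0 < t → ∀ j, G.Accepts p (some (Sum.inl e)) t (Sum.inr (Sum.inl j)) ↔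
        j ∈ e.1 ∧ t ≤ p (some (Sum.inr (Sum.inl j))) - 1 := by
      intro t ht j
      constructor
      · intro h
        have hj : j ∈ e.1 := by
          by_contra hj
          exact hna ht (by rw [hvje, if_neg hj]) h
        have h1 := h (some (Sum.inr (Sum.inl j))) (by simp)
        rw [hvjn, hvje, if_pos rfl, if_pos hj] at h1
        exact ⟨hj, by linarith⟩
      · rintro ⟨hj, h⟩ m' -
        have := hnode j m'
        rw [hvje, if_pos hj]
        linarith
    have hdem : ∀ t, 0 < t → G.demand p (some (Sum.inl e)) t =
        (if t ≤ ((k : ℝ) + 1) ^ 2 then 1 else 0) +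
          ((e.1.filter fun j => t ≤ p (some (Sum.inr (Sum.inl j))) - 1).card : ℝ) := by
      intro t ht
      rw [PCGame.demand, Fintype.sum_sum_type, Fintype.sum_sum_type]
      congr 1
      · rw [Fintype.sum_eq_single e]
        · simp only [hacce, hμe]
        · intro e' he
          exact if_neg (hna ht (by rw [hve, if_neg he]))
      · rw [Finset.sum_eq_zero (s := univ)
          (f := fun j => if G.Accepts p (some (Sum.inl e)) t (Sum.inr (Sum.inr j)) then _ else _)
          (fun j _ => if_neg (hna ht (hvse j e))), add_zero]
        simp only [haccn t ht, hμj, Finset.sum_boole]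
        congr 2
        ext j
        simp
    have hne : e.1.Nonempty := Finset.card_pos.mp (by rw [hE e.1 e.2]; omega)
    set I := e.1.inf' hne (fun j => p (some (Sum.inr (Sum.inl j))) - 1) with hI
    rw [PCGame.subsidy, G.theta_eq_of_demand p (hsome _) (hcost _)
      (θ := max (((k : ℝ) + 1) ^ 2) (((k : ℝ) + 1) * I))]
    · simp [PCGame.util, hxe, hxj, hxs, hcost, Fintype.sum_sum_type]
    · positivity
    · intro t ht
      rw [hdem t ht]
      set F := e.1.filter fun j => t ≤ p (some (Sum.inr (Sum.inl j))) - 1 with hF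
      have hite : (if t ≤ ((k : ℝ) + 1) ^ 2 then (1 : ℝ) else 0) ≤ 1 := by
        split_ifs <;> norm_num
      have hFk : F.card ≤ k := (Finset.card_filter_le _ _).trans (hE e.1 e.2).le
      rcases hFk.eq_or_lt with hFk | hFk
      · refine le_max_of_le_right ?_
        have hFe : F = e.1 := Finset.eq_of_subset_of_card_le (Finset.filter_subset _ _)
          (by rw [hFk, hE e.1 e.2])
        have htI : t ≤ I := by
          rw [hI, Finset.le_inf'_iff]
          intro j hj
          rw [← hFe, hF, Finset.mem_filter] at hj
          exact hj.2
        rw [hFk, mul_comm]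
        exact mul_le_mul (by linarith) htI ht.le (by positivity)
      · refine le_max_of_le_left ?_
        rcases F.eq_empty_or_nonempty with h0 | ⟨j, hj⟩
        · rw [h0]
          split_ifs with h
          · simpa using h
          · simpa using by positivity
        · have htj : t ≤ (k : ℝ) + 2 := by
            rw [hF, Finset.mem_filter] at hj
            linarith [hq j, hj.2]
          have hFr : (F.card : ℝ) + 1 ≤ k := by exact_mod_cast hFk
          calc t * (_ + (F.card : ℝ)) ≤ ((k : ℝ) + 2) * k :=
                mul_le_mul htj (by linarith) (by split_ifs <;> positivity) (by positivity)
            _ ≤ _ := by nlinarith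
    · rcases le_total (((k : ℝ) + 1) * I) (((k : ℝ) + 1) ^ 2) with h | h
      · refine ⟨((k : ℝ) + 1) ^ 2, by positivity, ?_⟩
        rw [max_eq_left h, hdem _ (by positivity), if_pos le_rfl]
        exact le_mul_of_one_le_right (by positivity) (by simp)
      · have hIk : (k : ℝ) + 1 ≤ I := by
          rw [sq] at h
          exact le_of_mul_le_mul_left h (by positivity)
        have hI0 : 0 < I := by linarith
        refine ⟨I, hI0, ?_⟩
        have hIle : ∀ j ∈ e.1, I ≤ p (some (Sum.inr (Sum.inl j))) - 1 :=
          fun j hj => Finset.inf'_le _ hj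
        have hI2 : I ≤ ((k : ℝ) + 1) ^ 2 := by
          obtain ⟨j, hj⟩ := hne
          nlinarith [hIle j hj, hq j]
        rw [max_eq_right h, hdem _ hI0, if_pos hI2, Finset.filter_true_of_mem hIle, hE e.1 e.2]
        linarith
  · intro A B
    have hleB : ∀ t, t ≤ B ↔ t ≤ (k : ℝ) + 3 ∧
        ∀ e : ↥E, j ∈ e.1 → t ≤ 1 + p (some (Sum.inl e)) := by
      intro t
      simp only [B, ← sub_le_iff_le_add', Finset.le_inf'_iff, Finset.forall_mem_insert,
        Finset.forall_mem_image, Finset.mem_filter, Finset.mem_attach, true_and, id]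
      refine and_congr ?_ Iff.rfl
      constructor <;> intro <;> linarith
    have haccj : ∀ t, G.Accepts p (some (Sum.inr (Sum.inl j))) t (Sum.inr (Sum.inl j)) ↔
        t ≤ B := by
      intro t
      rw [hleB]
      constructor
      · intro h
        constructor
        · have h1 := h none (by simp)
          simp only [hvn, hpn, hvjn, if_true] at h1
          linarith
        · intro e he
          have h1 := h (some (Sum.inl e)) (by simp)
          simp only [hvje, hvjn, if_true, if_pos he] at h1
          linarith
      · rintro ⟨h1, h2⟩ (_ | e | j' | j') hne
        · simp only [hvn, hpn, hvjn, if_true]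
          linarith
        · have := hp0 (some (Sum.inl e))
          by_cases hj : j ∈ e.1
          · have := h2 e hj
            simp only [hvje, hvjn, if_true, if_pos hj]
            linarith
          · simp only [hvje, hvjn, if_true, if_neg hj]
            linarith
        · have := hp0 (some (Sum.inr (Sum.inl j')))
          have hj : j ≠ j' := by
            rintro rfl
            exact hne rfl
          simp only [hvjn, if_true, if_neg hj]
          linarith
        · have := hp0 (some (Sum.inr (Sum.inr j')))
          simp only [hvjn, hvja, if_true]
          linarith
    have haccs : ∀ t, G.Accepts p (some (Sum.inr (Sum.inl j))) t (Sum.inr (Sum.inr j)) ↔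
        t ≤ A := by
      intro t
      constructor
      · intro h
        have h1 := h (some (Sum.inr (Sum.inr j))) (by simp)
        simp only [hvsn, hvsa, if_true] at h1
        simp only [A]
        linarith
      · rintro h m' -
        have := haux j m'
        simp only [A] at h
        simp only [hvsn, if_true]
        linarith
    have hdem : ∀ t, 0 < t → G.demand p (some (Sum.inr (Sum.inl j))) t =
        (if t ≤ B then 1 else 0) + if t ≤ A then 1 / ((k : ℝ) + 2) else 0 := by
      intro t ht
      rw [PCGame.demand, Fintype.sum_sum_type, Fintype.sum_sum_type,
        Finset.sum_eq_zero fun e _ => if_neg (hna ht (hven e j)), zero_add]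
      congr 1
      · rw [Fintype.sum_eq_single j]
        · simp only [haccj, hμj]
        · intro j' hj
          exact if_neg (hna ht (by rw [hvjn, if_neg hj]))
      · rw [Fintype.sum_eq_single j]
        · simp only [haccs, hμs]
        · intro j' hj
          exact if_neg (hna ht (by rw [hvsn, if_neg hj]))
    have hB : 1 ≤ B := (hleB 1).2 ⟨by linarith, fun e _ => by linarith [hp0 (some (Sum.inl e))]⟩
    have hAB : A ≤ B := by
      have h1 : A ≤ p (some (Sum.inr (Sum.inl j))) := by
        simp only [A]
        linarith [haq j]
      exact h1.trans ((hleB _).2 ⟨hq j, hqe j⟩)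
    have hsum : 1 + 1 / ((k : ℝ) + 2) = ((k : ℝ) + 3) / ((k : ℝ) + 2) := by
      field_simp
      ring
    have hmax : max (((k : ℝ) + 3) / ((k : ℝ) + 2) * min A B)
        ((if B ≤ A then 1 / ((k : ℝ) + 2) else 1) * max A B) =
        max ((1 + 1 / ((k : ℝ) + 2)) * A) B := by
      rw [hsum, min_eq_left hAB, max_eq_right hAB]
      split_ifs with h
      · rw [← hsum, le_antisymm hAB h, max_eq_left, max_eq_left] <;> nlinarith
      · rw [one_mul]
    rw [hmax, PCGame.subsidy, G.theta_eq_of_demand p (hsome _) (hcost _)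
      (θ := max ((1 + 1 / ((k : ℝ) + 2)) * A) B)]
    · simp [PCGame.util, hxe, hxj, hxs, hcost, Fintype.sum_sum_type]
    · exact le_max_of_le_right (by linarith)
    · intro t ht
      rw [hdem t ht]
      by_cases h1 : t ≤ A
      · rw [if_pos (h1.trans hAB), if_pos h1, mul_comm]
        exact le_max_of_le_left (mul_le_mul_of_nonneg_left h1 (by positivity))
      · refine le_max_of_le_right ?_
        rw [if_neg h1]
        split_ifs <;> linarith
    · rcases le_total ((1 + 1 / ((k : ℝ) + 2)) * A) B with h | h
      · refine ⟨B, by linarith, ?_⟩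
        rw [max_eq_right h, hdem B (by linarith), if_pos le_rfl]
        exact le_mul_of_one_le_right (by linarith) (by split_ifs <;> linarith)
      · have hA : 0 < A := by
          by_contra! hA
          nlinarith
        refine ⟨A, hA, ?_⟩
        rw [max_eq_left h, hdem A hA, if_pos hAB, if_pos le_rfl, mul_comm]
end
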